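/- Let g = 1/138, δ* ∈ (0,1] and ε* = (1−4gδ*)/8 (so ε* < 1/8), and let F = (X,Y,A,B,V) be a free game with |X| and |Y| even and ω(F) ≤ 1 − δ*. Then a mixed strategy pair (x,y) is an ε*-WSNE of the game G'(F) if and only if x_𝔦 = 1 and y_𝔧 = 1; that is, the pure profile (𝔦,𝔧) is the unique ε*-WSNE of G'(F). -/

import Mathlib

open Finset

section Bimatrix

variable {I J : Type*} [Fintype I] [Fintype J]

/-- A mixed strategy: a probability distribution on a finite type. -/
def IsDist (x : I → ℝ) : Prop := (∀ i, 0 ≤ x i) ∧ ∑ i, x i = 1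

/-- Expected payoff `xᵀ M y`. -/
noncomputable def pay (M : I → J → ℝ) (x : I → ℝ) (y : J → ℝ) : ℝ :=
  ∑ i, ∑ j, x i * M i j * y j

/-- `(M y)_i`, the payoff of pure row `i` against mixed strategy `y`. -/
noncomputable def rowPay (M : I → J → ℝ) (y : J → ℝ) (i : I) : ℝ := ∑ j, M i j * y j

/-- `(xᵀ M)_j`, the payoff of pure column `j` against mixed strategy `x`. -/
noncomputable def colPay (M : I → J → ℝ) (x : I → ℝ) (j : J) : ℝ := ∑ i, x i * M i j

/-- Social welfare. -/
noncomputable def sw (R C : I → J → ℝ) (x : I → ℝ) (y : J → ℝ) : ℝ := pay R x y + pay C x y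

/-- `(x,y)` is an ε-approximate Nash equilibrium of the bimatrix game `(R,C)`. -/
def IsEpsNE (R C : I → J → ℝ) (x : I → ℝ) (y : J → ℝ) (ε : ℝ) : Prop :=
  IsDist x ∧ IsDist y ∧
  (∀ i, rowPay R y i - pay R x y ≤ ε) ∧
  (∀ j, colPay C x j - pay C x y ≤ ε)

/-- `(x,y)` is an ε-well-supported Nash equilibrium of `(R,C)`. -/
def IsEpsWSNE (R C : I → J → ℝ) (x : I → ℝ) (y : J → ℝ) (ε : ℝ) : Prop :=
  IsDist x ∧ IsDist y ∧
  (∀ i, 0 < x i → ∀ k, rowPay R y k - rowPay R y i ≤ ε) ∧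
  (∀ j, 0 < y j → ∀ k, colPay C x k - colPay C x j ≤ ε)

end Bimatrix

/-- ℓ₁ norm of a finitely-indexed real vector. -/
noncomputable def l1 {I : Type*} [Fintype I] (v : I → ℝ) : ℝ := ∑ i, |v i|

section FreeGame

variable {X Y A B : Type*} [Fintype X] [Fintype Y] [Fintype A] [Fintype B]

/-- Payoff of a strategy pair in the free game with verifier `V`. -/
noncomputable def freePayoff (V : X → Y → A → B → ℝ) (s₁ : X → A) (s₂ : Y → B) : ℝ :=
  (1 / ((Fintype.card X : ℝ) * (Fintype.card Y : ℝ))) * ∑ x, ∑ y, V x y (s₁ x) (s₂ y)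

/-- Value `ω(F)` of the free game: the best payoff over all strategy pairs. -/
noncomputable def gameValue [Nonempty A] [Nonempty B] (V : X → Y → A → B → ℝ) : ℝ :=
  ⨆ s : (X → A) × (Y → B), freePayoff V s.1 s.2

end FreeGame

/-- Functions selecting exactly half of the elements of a finite type. -/
abbrev HalfFns (Y : Type*) [Fintype Y] : Type _ :=
  {f : Y → Bool // 2 * (Finset.univ.filter (fun y => f y = true)).card = Fintype.card Y}

section GGame

variable {X Y A B : Type*} [Fintype X] [Fintype Y] [Fintype A] [Fintype B]

/-- Row player's payoffs in the game `G(F,g,δ)`. -/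
noncomputable def GRow (V : X → Y → A → B → ℝ) (g δ : ℝ) :
    X × A ⊕ HalfFns Y → Y × B ⊕ HalfFns X → ℝ
  | Sum.inl (q, a), Sum.inl (r, b) => V q r a b
  | Sum.inr f, Sum.inl (r, _) => if f.1 r then 4 / (1 + 4 * g * δ) else 0
  | Sum.inl (q, _), Sum.inr f => -(if f.1 q then 4 / (1 + 4 * g * δ) else 0)
  | Sum.inr _, Sum.inr _ => 0

/-- Column player's payoffs in the game `G(F,g,δ)`. -/
noncomputable def GCol (V : X → Y → A → B → ℝ) (g δ : ℝ) :
    X × A ⊕ HalfFns Y → Y × B ⊕ HalfFns X → ℝ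
  | Sum.inl (q, a), Sum.inl (r, b) => V q r a b
  | Sum.inr f, Sum.inl (r, _) => -(if f.1 r then 4 / (1 + 4 * g * δ) else 0)
  | Sum.inl (q, _), Sum.inr f => if f.1 q then 4 / (1 + 4 * g * δ) else 0
  | Sum.inr _, Sum.inr _ => 0

/-- Question marginal of a row-player mixed strategy of `G(F,g,δ)`. -/
noncomputable def rowMarg (x : X × A ⊕ HalfFns Y → ℝ) (q : X) : ℝ := ∑ a, x (Sum.inl (q, a))

/-- Question marginal of a column-player mixed strategy of `G(F,g,δ)`. -/
noncomputable def colMarg (y : Y × B ⊕ HalfFns X → ℝ) (r : Y) : ℝ := ∑ b, y (Sum.inl (r, b))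

/-- Payoff of the two-prover game `T_{(x,y)}` with question distributions `x'`, `y'`. -/
noncomputable def tpPay (V : X → Y → A → B → ℝ) (x' : X → ℝ) (y' : Y → ℝ)
    (s₁ : X → A) (s₂ : Y → B) : ℝ :=
  ∑ q, ∑ r, x' q * y' r * V q r (s₁ q) (s₂ r)

/-- Row payoffs of the rescaled game `G_s(F,g,δ)`. -/
noncomputable def GsRow (V : X → Y → A → B → ℝ) (g δ : ℝ)
    (i : X × A ⊕ HalfFns Y) (j : Y × B ⊕ HalfFns X) : ℝ := (GRow V g δ i j + 4) / 8

/-- Column payoffs of the rescaled game `G_s(F,g,δ)`. -/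
noncomputable def GsCol (V : X → Y → A → B → ℝ) (g δ : ℝ)
    (i : X × A ⊕ HalfFns Y) (j : Y × B ⊕ HalfFns X) : ℝ := (GCol V g δ i j + 4) / 8

/-- Row payoffs of `G'(F)`, extending `G_s` by a new row `𝔦` and a new column `𝔧`
(the `Sum.inr` components); here `ε* = (1 - 4gδ)/8`. -/
noncomputable def G'Row (V : X → Y → A → B → ℝ) (g δ : ℝ) :
    (X × A ⊕ HalfFns Y) ⊕ Unit → (Y × B ⊕ HalfFns X) ⊕ Unit → ℝ
  | Sum.inl i, Sum.inl j => GsRow V g δ i j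
  | Sum.inr _, Sum.inl _ => 5 / 8 + (1 - 4 * g * δ) / 8
  | Sum.inl _, Sum.inr _ => 0
  | Sum.inr _, Sum.inr _ => 1

/-- Column payoffs of `G'(F)`. -/
noncomputable def G'Col (V : X → Y → A → B → ℝ) (g δ : ℝ) :
    (X × A ⊕ HalfFns Y) ⊕ Unit → (Y × B ⊕ HalfFns X) ⊕ Unit → ℝ
  | Sum.inl i, Sum.inl j => GsCol V g δ i j
  | Sum.inr _, Sum.inl _ => 0
  | Sum.inl _, Sum.inr _ => 5 / 8 + (1 - 4 * g * δ) / 8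
  | Sum.inr _, Sum.inr _ => 1

/-- Row payoffs of `G''(F)`, extending `G'` by a new row `𝔦'` and a new column `𝔧'`. -/
noncomputable def G''Row (V : X → Y → A → B → ℝ) (g δ : ℝ) :
    ((X × A ⊕ HalfFns Y) ⊕ Unit) ⊕ Unit → ((Y × B ⊕ HalfFns X) ⊕ Unit) ⊕ Unit → ℝ
  | Sum.inl i, Sum.inl j => G'Row V g δ i j
  | Sum.inr _, Sum.inl _ => 5 / 8
  | Sum.inl _, Sum.inr _ => 5 / 8
  | Sum.inr _, Sum.inr _ => 0

/-- Column payoffs of `G''(F)`. -/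
noncomputable def G''Col (V : X → Y → A → B → ℝ) (g δ : ℝ) :
    ((X × A ⊕ HalfFns Y) ⊕ Unit) ⊕ Unit → ((Y × B ⊕ HalfFns X) ⊕ Unit) ⊕ Unit → ℝ
  | Sum.inl i, Sum.inl j => G'Col V g δ i j
  | Sum.inr _, Sum.inl _ => 5 / 8
  | Sum.inl _, Sum.inr _ => 5 / 8
  | Sum.inr _, Sum.inr _ => 0

end GGame

section ClauseVar

variable {Vars : Type*}

/-- An assignment `α` satisfies a 3-clause `c` (a literal `(v, b)` stands for `v`
if `b = true` and for `¬v` if `b = false`). -/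
def SatClause (α : Vars → Bool) (c : Finset (Vars × Bool)) : Prop :=
  ∃ l ∈ c, α l.1 = l.2

open Classical in
/-- The verifier of the clause–variable free game associated to partitions
`S` of the variables and `T` of the clauses. -/
noncomputable def clauseVarV {m : ℕ} (S : Fin m → Finset Vars)
    (T : Fin m → Finset (Finset (Vars × Bool)))
    (i j : Fin m) (α β : Vars → Bool) : ℝ :=
  if (∀ c ∈ T j, SatClause β c) ∧
      (∀ v ∈ S i, (∃ c ∈ T j, ∃ p : Bool, (v, p) ∈ c) → α v = β v) then 1 else 0

end ClauseVar

section SupportSize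

/-- Among the subsets of `S` of a given size, some subset has at least average weight. -/
theorem exists_subset_card_mul_sum_le {α : Type*} (μ : α → ℝ) (m : ℕ) (S : Finset α)
    (hm : m ≤ S.card) (hμ : ∀ i ∈ S, 0 ≤ μ i) :
    ∃ T ⊆ S, T.card = m ∧ (m : ℝ) * ∑ i ∈ S, μ i ≤ S.card * ∑ i ∈ T, μ i := by
  classical
  induction S using Finset.strongInduction with
  | H S ih =>
    rcases hm.eq_or_lt with h | h
    · exact ⟨S, Finset.Subset.refl S, h.symm, by rw [h]⟩
    · have hne : S.Nonempty := Finset.card_pos.mp (by omega)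
      obtain ⟨a, ha, hmin⟩ := Finset.exists_min_image S μ hne
      have hcard := Finset.card_erase_add_one ha
      obtain ⟨T, hTS, hTm, hT⟩ := ih (S.erase a) (Finset.erase_ssubset ha) (by omega)
        (fun i hi => hμ i (Finset.mem_of_mem_erase hi))
      refine ⟨T, hTS.trans (Finset.erase_subset _ _), hTm, ?_⟩
      have hsum := Finset.add_sum_erase S μ ha
      have hTmin : (m : ℝ) * μ a ≤ ∑ i ∈ T, μ i := by
        have := Finset.card_nsmul_le_sum T μ (μ a)
          (fun i hi => hmin i (Finset.mem_of_mem_erase (hTS hi)))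
        rwa [hTm, nsmul_eq_mul] at this
      have hc : (S.card : ℝ) = (S.erase a).card + 1 := by exact_mod_cast hcard.symm
      rw [← hsum, hc]
      linarith

/-- A distribution giving every half of its domain mass at most `(1 + t) / 2`
has large support. -/
theorem card_le_card_support_mul {X : Type*} [Fintype X] (hX : Even (Fintype.card X))
    (μ : X → ℝ) (hμ : IsDist μ) (t : ℝ) (ht : t < 1)
    (hhalf : ∀ f : HalfFns X, ∑ q, (if f.1 q then μ q else 0) ≤ (1 + t) / 2)
    (S : Finset X) (hS : ∀ q ∉ S, μ q = 0) :
    (Fintype.card X : ℝ) ≤ S.card * (1 + t) := by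
  classical
  obtain ⟨m, hm⟩ := hX
  have hmass : ∀ T : Finset X, T.card = m → ∑ q ∈ T, μ q ≤ (1 + t) / 2 := by
    intro T hT
    have hf : 2 * (Finset.univ.filter (fun q => decide (q ∈ T) = true)).card
        = Fintype.card X := by
      simp [hT, hm]; omega
    have := hhalf ⟨fun q => decide (q ∈ T), hf⟩
    simpa [Finset.sum_ite_mem] using this
  have hsumS : ∑ q ∈ S, μ q = 1 := by
    rw [← hμ.2]
    exact Finset.sum_subset (Finset.subset_univ S) (fun q _ hq => hS q hq)
  have hcard : (Fintype.card X : ℝ) = m + m := by exact_mod_cast hm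
  rcases le_total m S.card with h | h
  · obtain ⟨T, -, hTm, hT⟩ := exists_subset_card_mul_sum_le μ m S h (fun i _ => hμ.1 i)
    have h1 := hmass T hTm
    have h2 : (S.card : ℝ) * ∑ q ∈ T, μ q ≤ S.card * ((1 + t) / 2) := by gcongr
    rw [hsumS] at hT
    linarith
  · obtain ⟨T, hST, hTm⟩ := Finset.exists_superset_card_eq h (by omega)
    have h1 := hmass T hTm
    have h2 := Finset.sum_le_sum_of_subset_of_nonneg hST (f := μ) (fun i _ _ => hμ.1 i)
    linarith

end SupportSize

section RowSide

variable {X Y A B : Type*} [Fintype X] [Fintype Y]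

theorem GCol_eq_GRow_swap (V : X → Y → A → B → ℝ) (g δ : ℝ)
    (i : X × A ⊕ HalfFns Y) (j : Y × B ⊕ HalfFns X) :
    GCol V g δ i j = GRow (fun r q b a => V q r a b) g δ j i := by
  rcases i with ⟨q, a⟩ | f <;> rcases j with ⟨r, b⟩ | f' <;> rfl

/-- The two payoffs of `G(F,g,δ)` sum to at most two. -/
theorem GRow_add_GCol_le (V : X → Y → A → B → ℝ)
    (hV : ∀ x y a b, V x y a b = 0 ∨ V x y a b = 1) (g δ : ℝ)
    (i : X × A ⊕ HalfFns Y) (j : Y × B ⊕ HalfFns X) :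
    GRow V g δ i j + GCol V g δ i j ≤ 2 := by
  rcases i with ⟨q, a⟩ | f <;> rcases j with ⟨r, b⟩ | f' <;> simp only [GRow, GCol]
  · rcases hV q r a b with h | h <;> rw [h] <;> norm_num
  all_goals linarith

/-- The two payoffs of `G(F,g,δ)` sum to two only at accepted question-answer pairs. -/
theorem accepted_of_GRow_add_GCol_eq (V : X → Y → A → B → ℝ) (g δ : ℝ)
    (i : X × A ⊕ HalfFns Y) (j : Y × B ⊕ HalfFns X)
    (h : GRow V g δ i j + GCol V g δ i j = 2) :
    ∃ q a r b, i = Sum.inl (q, a) ∧ j = Sum.inl (r, b) ∧ V q r a b = 1 := by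
  rcases i with ⟨q, a⟩ | f <;> rcases j with ⟨r, b⟩ | f' <;> simp only [GRow, GCol] at h
  · exact ⟨q, a, r, b, rfl, rfl, by linarith⟩
  all_goals linarith

theorem sum_inl_add_inr {I : Type*} [Fintype I] {x : I ⊕ Unit → ℝ} (hx : IsDist x) :
    ∑ i, x (Sum.inl i) + x (Sum.inr ()) = 1 := by
  simpa [Fintype.sum_sum_type] using hx.2

theorem inl_eq_zero_of_inr_eq_one {I : Type*} [Fintype I] {x : I ⊕ Unit → ℝ} (hx : IsDist x)
    (hone : x (Sum.inr ()) = 1) (i : I) : x (Sum.inl i) = 0 := by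
  have hq : ∑ i, x (Sum.inl i) = 0 := by have := sum_inl_add_inr hx; linarith
  exact (Finset.sum_eq_zero_iff_of_nonneg (fun i _ => hx.1 _)).mp hq i (Finset.mem_univ i)

/-- If an accepting strategy pair exists on a product of question sets, the value of the
game is at least the density of that product. -/
theorem card_mul_card_le_gameValue [Fintype A] [Fintype B] [Nonempty A] [Nonempty B]
    (V : X → Y → A → B → ℝ)
    (hV : ∀ x y a b, V x y a b = 0 ∨ V x y a b = 1) (s₁ : X → A) (s₂ : Y → B)
    (S : Finset X) (T : Finset Y)
    (h : ∀ q ∈ S, ∀ r ∈ T, V q r (s₁ q) (s₂ r) = 1) :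
    1 / ((Fintype.card X : ℝ) * Fintype.card Y) * (S.card * T.card) ≤ gameValue V := by
  have hV0 : ∀ q r, 0 ≤ V q r (s₁ q) (s₂ r) := by
    intro q r
    rcases hV q r (s₁ q) (s₂ r) with h | h <;> rw [h]
    exact zero_le_one
  have hsum : (S.card : ℝ) * T.card ≤ ∑ q, ∑ r, V q r (s₁ q) (s₂ r) := calc
    (S.card : ℝ) * T.card = ∑ q ∈ S, ∑ r ∈ T, V q r (s₁ q) (s₂ r) := by
      rw [Finset.sum_congr rfl (fun q hq => Finset.sum_congr rfl (h q hq))]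
      simp
    _ ≤ ∑ q ∈ S, ∑ r, V q r (s₁ q) (s₂ r) :=
      Finset.sum_le_sum (fun q _ => Finset.sum_le_sum_of_subset_of_nonneg
        (Finset.subset_univ T) (fun r _ _ => hV0 q r))
    _ ≤ ∑ q, ∑ r, V q r (s₁ q) (s₂ r) :=
      Finset.sum_le_sum_of_subset_of_nonneg (Finset.subset_univ S)
        (fun q _ _ => Finset.sum_nonneg (fun r _ => hV0 q r))
  have hbdd : BddAbove (Set.range
      (fun s : (X → A) × (Y → B) => freePayoff V s.1 s.2)) := Set.Finite.bddAbove (Set.toFinite _)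
  refine le_trans ?_ (le_ciSup hbdd (s₁, s₂))
  exact mul_le_mul_of_nonneg_left hsum (by positivity)

theorem rowPay_G'Row_inl [Fintype B] [DecidableEq X] (V : X → Y → A → B → ℝ) (g δ : ℝ)
    (y : (Y × B ⊕ HalfFns X) ⊕ Unit → ℝ) (i : X × A ⊕ HalfFns Y) :
    rowPay (G'Row V g δ) y (Sum.inl i)
      = (∑ j, GRow V g δ i j * y (Sum.inl j) + 4 * ∑ j, y (Sum.inl j)) / 8 := by
  rw [rowPay, Fintype.sum_sum_type]
  simp only [G'Row, GsRow, zero_mul, Finset.sum_const_zero, add_zero]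
  rw [Finset.mul_sum, ← Finset.sum_add_distrib, Finset.sum_div]
  exact Finset.sum_congr rfl (fun j _ => by ring)

theorem rowPay_G'Row_inr [Fintype B] [DecidableEq X] (V : X → Y → A → B → ℝ) (g δ : ℝ)
    (y : (Y × B ⊕ HalfFns X) ⊕ Unit → ℝ) :
    rowPay (G'Row V g δ) y (Sum.inr ())
      = (5 / 8 + (1 - 4 * g * δ) / 8) * ∑ j, y (Sum.inl j) + y (Sum.inr ()) := by
  rw [rowPay, Fintype.sum_sum_type]
  simp [G'Row, ← Finset.mul_sum]

theorem colPay_G'Col [Fintype A] [DecidableEq Y] (V : X → Y → A → B → ℝ) (g δ : ℝ)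
    (x : (X × A ⊕ HalfFns Y) ⊕ Unit → ℝ) (j : (Y × B ⊕ HalfFns X) ⊕ Unit) :
    colPay (G'Col V g δ) x j = rowPay (G'Row (fun r q b a => V q r a b) g δ) x j := by
  unfold colPay rowPay
  refine Finset.sum_congr rfl (fun i _ => ?_)
  rw [mul_comm]
  rcases i with (⟨q, a⟩ | f) | _ <;> rcases j with (⟨r, b⟩ | f') | _ <;> rfl

theorem isDist_colMarg [Fintype B] [DecidableEq X]
    (y : (Y × B ⊕ HalfFns X) ⊕ Unit → ℝ) (hy : IsDist y)
    (hy1 : ∑ j, y (Sum.inl j) = 1) (hy0 : ∀ j, y (Sum.inl (Sum.inr j)) = 0) :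
    IsDist (colMarg (fun j => y (Sum.inl j))) := by
  refine ⟨fun r => Finset.sum_nonneg (fun b _ => hy.1 _), ?_⟩
  rw [Fintype.sum_sum_type, Fintype.sum_prod_type] at hy1
  simpa [hy0, colMarg] using hy1

/-- When the play is concentrated on accepted question-answer pairs, the column player's
question marginal gives no half of the questions much more than half of the mass. -/
theorem half_mass_le [Fintype B] [DecidableEq X] (V : X → Y → A → B → ℝ) (g δ ε t : ℝ)
    (hε : ε = (1 - 4 * g * δ) / 8) (ht : 4 * g * δ = 2 * t) (ht0 : 0 ≤ t)
    (x : (X × A ⊕ HalfFns Y) ⊕ Unit → ℝ) (y : (Y × B ⊕ HalfFns X) ⊕ Unit → ℝ)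
    (hr : ∀ i, 0 < x i → ∀ k,
      rowPay (G'Row V g δ) y k - rowPay (G'Row V g δ) y i ≤ ε)
    (hy1 : ∑ j, y (Sum.inl j) = 1)
    (hy : ∀ j, y (Sum.inl (Sum.inr j)) = 0)
    (i : X × A ⊕ HalfFns Y) (hi : 0 < x (Sum.inl i))
    (hacc : ∀ j, GRow V g δ i j * y (Sum.inl j) = y (Sum.inl j))
    (f : HalfFns Y) :
    ∑ r, (if f.1 r then colMarg (fun j => y (Sum.inl j)) r else 0) ≤ (1 + t) / 2 := by
  have h := hr _ hi (Sum.inl (Sum.inr f))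
  rw [rowPay_G'Row_inl, rowPay_G'Row_inl] at h
  simp only [hacc, hy1] at h
  have hsum : ∑ j, GRow V g δ (Sum.inr f) j * y (Sum.inl j)
      = 4 / (1 + 4 * g * δ)
        * ∑ r, (if f.1 r then colMarg (fun j => y (Sum.inl j)) r else 0) := by
    rw [Fintype.sum_sum_type, Fintype.sum_prod_type, Finset.mul_sum]
    simp only [hy, mul_zero, Finset.sum_const_zero, add_zero, GRow, colMarg]
    refine Finset.sum_congr rfl (fun r _ => ?_)
    split_ifs
    · rw [Finset.mul_sum]
    · simp
  rw [hsum, hε, ht] at h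
  set M := ∑ r, (if f.1 r then colMarg (fun j => y (Sum.inl j)) r else 0)
  have hM : 4 / (1 + 2 * t) * M ≤ 2 - 2 * t := by linarith
  rw [div_mul_eq_mul_div, div_le_iff₀ (by positivity)] at hM
  nlinarith [sq_nonneg t]

variable [Fintype A] [Fintype B] [DecidableEq X] [DecidableEq Y]

/-- If the new column has probability one, then so has the new row. -/
theorem inr_eq_one_of_inr_eq_one (V : X → Y → A → B → ℝ) (g δ ε : ℝ) (hε : ε < 1)
    (x : (X × A ⊕ HalfFns Y) ⊕ Unit → ℝ) (y : (Y × B ⊕ HalfFns X) ⊕ Unit → ℝ)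
    (hx : IsDist x) (hy : IsDist y)
    (hr : ∀ i, 0 < x i → ∀ k,
      rowPay (G'Row V g δ) y k - rowPay (G'Row V g δ) y i ≤ ε)
    (hone : y (Sum.inr ()) = 1) : x (Sum.inr ()) = 1 := by
  have hy0 := inl_eq_zero_of_inr_eq_one hy hone
  have hx0 : ∀ i, x (Sum.inl i) = 0 := by
    intro i
    by_contra hne
    have h := hr _ (lt_of_le_of_ne (hx.1 _) (Ne.symm hne)) (Sum.inr ())
    rw [rowPay_G'Row_inl, rowPay_G'Row_inr] at h
    simp only [hy0, hone, mul_zero, Finset.sum_const_zero] at h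
    linarith
  have h := sum_inl_add_inr hx
  simpa [hx0] using h

/-- Well-supported rows of `G(F,g,δ)` do well against the part of the column strategy
inside `G(F,g,δ)`. -/
theorem weighted_GRow_ge (V : X → Y → A → B → ℝ) (g δ ε : ℝ)
    (hε : ε = (1 - 4 * g * δ) / 8) (hε8 : ε ≤ 1 / 8)
    (x : (X × A ⊕ HalfFns Y) ⊕ Unit → ℝ) (y : (Y × B ⊕ HalfFns X) ⊕ Unit → ℝ)
    (hx : IsDist x) (hy : IsDist y)
    (hr : ∀ i, 0 < x i → ∀ k,
      rowPay (G'Row V g δ) y k - rowPay (G'Row V g δ) y i ≤ ε) :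
    (∑ i, x (Sum.inl i)) * (∑ j, y (Sum.inl j) + 7 * y (Sum.inr ()))
      ≤ ∑ i, ∑ j, x (Sum.inl i) * y (Sum.inl j) * GRow V g δ i j := by
  rw [Finset.sum_mul]
  refine Finset.sum_le_sum (fun i _ => ?_)
  have hfac : ∑ j, x (Sum.inl i) * y (Sum.inl j) * GRow V g δ i j
      = x (Sum.inl i) * ∑ j, GRow V g δ i j * y (Sum.inl j) := by
    rw [Finset.mul_sum]
    exact Finset.sum_congr rfl (fun j _ => by ring)
  rw [hfac]
  rcases (hx.1 (Sum.inl i)).eq_or_lt with h0 | hpos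
  · rw [← h0]; simp
  · refine mul_le_mul_of_nonneg_left ?_ hpos.le
    have h := hr _ hpos (Sum.inr ())
    rw [rowPay_G'Row_inl, rowPay_G'Row_inr, ← hε] at h
    have hy1 := sum_inl_add_inr hy
    have hp := hy.1 (Sum.inr ())
    have hq : ∑ j, y (Sum.inl j) = 1 - y (Sum.inr ()) := by linarith
    rw [hq] at h ⊢
    nlinarith [mul_nonneg hp (sub_nonneg.mpr hε8)]

/-- A profile concentrated on the new row and column is well supported for the row player. -/
theorem row_wellSupported_of_inr_eq_one (V : X → Y → A → B → ℝ) (g δ ε : ℝ) (hε : 0 ≤ ε)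
    (x : (X × A ⊕ HalfFns Y) ⊕ Unit → ℝ) (y : (Y × B ⊕ HalfFns X) ⊕ Unit → ℝ)
    (hx : IsDist x) (hy : IsDist y)
    (hx1 : x (Sum.inr ()) = 1) (hy1 : y (Sum.inr ()) = 1) :
    ∀ i, 0 < x i → ∀ k, rowPay (G'Row V g δ) y k - rowPay (G'Row V g δ) y i ≤ ε := by
  have hy0 := inl_eq_zero_of_inr_eq_one hy hy1
  rintro (i | _) hi k
  · exact absurd (inl_eq_zero_of_inr_eq_one hx hx1 i) hi.ne'
  · rcases k with k | _
    · rw [rowPay_G'Row_inl, rowPay_G'Row_inr]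
      simp only [hy0, hy1, mul_zero, Finset.sum_const_zero]
      linarith
    · simpa using hε

end RowSide

/-- Lemma 14: with `g = 1/138`, `ε* = (1-4gδ*)/8`, if `ω(F) ≤ 1 - δ*`
then the pure profile `(𝔦,𝔧)` is the unique `ε*`-WSNE of `G'(F)`. -/
theorem Gprime_unique_WSNE {X Y A B : Type*}
    [Fintype X] [Fintype Y] [Fintype A] [Fintype B]
    [DecidableEq X] [DecidableEq Y]
    [Nonempty X] [Nonempty Y] [Nonempty A] [Nonempty B]
    (V : X → Y → A → B → ℝ) (hV : ∀ x y a b, V x y a b = 0 ∨ V x y a b = 1)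
    (hX : Even (Fintype.card X)) (hY : Even (Fintype.card Y))
    (g δ ε : ℝ) (hg : g = 1 / 138) (hδ0 : 0 < δ) (hδ : δ ≤ 1)
    (hε : ε = (1 - 4 * g * δ) / 8)
    (hω : gameValue V ≤ 1 - δ) :
    ∀ (x : (X × A ⊕ HalfFns Y) ⊕ Unit → ℝ) (y : (Y × B ⊕ HalfFns X) ⊕ Unit → ℝ),
      IsDist x → IsDist y →
      (IsEpsWSNE (G'Row V g δ) (G'Col V g δ) x y ε ↔
        (x (Sum.inr ()) = 1 ∧ y (Sum.inr ()) = 1)) := by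
  intro x y hx hy
  have hε0 : 0 ≤ ε := by rw [hε, hg]; linarith
  have hε8 : ε ≤ 1 / 8 := by rw [hε, hg]; linarith
  constructor
  swap
  · rintro ⟨hx1, hy1⟩
    refine ⟨hx, hy, row_wellSupported_of_inr_eq_one V g δ ε hε0 x y hx hy hx1 hy1, ?_⟩
    simp only [colPay_G'Col]
    exact row_wellSupported_of_inr_eq_one _ g δ ε hε0 y x hy hx hy1 hx1
  rintro ⟨-, -, hr, hc⟩
  simp only [colPay_G'Col] at hc
  by_contra hcon
  have hx1 : x (Sum.inr ()) ≠ 1 := fun h =>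
    hcon ⟨h, inr_eq_one_of_inr_eq_one _ g δ ε (by linarith) y x hy hx hc h⟩
  have hy1 : y (Sum.inr ()) ≠ 1 := fun h =>
    hcon ⟨inr_eq_one_of_inr_eq_one V g δ ε (by linarith) x y hx hy hr h, h⟩
  have hxs := sum_inl_add_inr hx
  have hys := sum_inl_add_inr hy
  have hR := weighted_GRow_ge V g δ ε hε hε8 x y hx hy hr
  have hC := weighted_GRow_ge _ g δ ε hε hε8 y x hy hx hc
  rw [Finset.sum_comm] at hC
  simp only [← GCol_eq_GRow_swap] at hC
  have hP0 : 0 ≤ ∑ i, x (Sum.inl i) := Finset.sum_nonneg (fun i _ => hx.1 _)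
  have hQ0 : 0 ≤ ∑ j, y (Sum.inl j) := Finset.sum_nonneg (fun j _ => hy.1 _)
  have hp0 := hx.1 (Sum.inr ())
  have hq0 := hy.1 (Sum.inr ())
  have hP : 0 < ∑ i, x (Sum.inl i) :=
    lt_of_le_of_ne hP0 (fun h => hx1 (by linarith))
  have hQ : 0 < ∑ j, y (Sum.inl j) :=
    lt_of_le_of_ne hQ0 (fun h => hy1 (by linarith))
  have hterm : ∀ i j, 0 ≤ x (Sum.inl i) * y (Sum.inl j)
      * (2 - (GRow V g δ i j + GCol V g δ i j)) := fun i j =>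
    mul_nonneg (mul_nonneg (hx.1 _) (hy.1 _))
      (sub_nonneg.mpr (GRow_add_GCol_le V hV g δ i j))
  have hslack : ∑ i, ∑ j, x (Sum.inl i) * y (Sum.inl j)
        * (2 - (GRow V g δ i j + GCol V g δ i j))
      = 2 * ((∑ i, x (Sum.inl i)) * ∑ j, y (Sum.inl j))
        - ∑ i, ∑ j, x (Sum.inl i) * y (Sum.inl j) * GRow V g δ i j
        - ∑ i, ∑ j, y (Sum.inl j) * x (Sum.inl i) * GCol V g δ i j := by
    rw [Finset.sum_mul_sum, Finset.mul_sum, ← Finset.sum_sub_distrib, ← Finset.sum_sub_distrib]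
    refine Finset.sum_congr rfl (fun i _ => ?_)
    rw [Finset.mul_sum, ← Finset.sum_sub_distrib, ← Finset.sum_sub_distrib]
    exact Finset.sum_congr rfl (fun j _ => by ring)
  have hslack0 : 0 ≤ ∑ i, ∑ j, x (Sum.inl i) * y (Sum.inl j)
        * (2 - (GRow V g δ i j + GCol V g δ i j)) :=
    Finset.sum_nonneg (fun i _ => Finset.sum_nonneg (fun j _ => hterm i j))
  have hq : y (Sum.inr ()) = 0 := by
    by_contra hne
    have h1 := mul_pos hP (lt_of_le_of_ne hq0 (Ne.symm hne))
    have h2 := mul_nonneg hQ0 hp0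
    linarith
  have hp : x (Sum.inr ()) = 0 := by
    by_contra hne
    have h1 := mul_nonneg hP0 hq0
    have h2 := mul_pos hQ (lt_of_le_of_ne hp0 (Ne.symm hne))
    linarith
  have hP1 : ∑ i, x (Sum.inl i) = 1 := by linarith
  have hQ1 : ∑ j, y (Sum.inl j) = 1 := by linarith
  have hacc : ∀ i j, 0 < x (Sum.inl i) → 0 < y (Sum.inl j) →
      GRow V g δ i j + GCol V g δ i j = 2 := by
    intro i j hi hj
    rw [hP1, hQ1, hq] at hR
    rw [hP1, hQ1, hp] at hC
    rw [hP1, hQ1] at hslack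
    have hz : ∑ i, ∑ j, x (Sum.inl i) * y (Sum.inl j)
        * (2 - (GRow V g δ i j + GCol V g δ i j)) = 0 := by linarith
    have h1 := (Finset.sum_eq_zero_iff_of_nonneg
      (fun i _ => Finset.sum_nonneg (fun j _ => hterm i j))).mp hz i (Finset.mem_univ i)
    have h2 := (Finset.sum_eq_zero_iff_of_nonneg
      (fun j _ => hterm i j)).mp h1 j (Finset.mem_univ j)
    have h3 := (mul_eq_zero.mp h2).resolve_left (mul_pos hi hj).ne'
    linarith
  obtain ⟨i₀, -, hi₀⟩ := Finset.exists_lt_of_sum_lt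
    (show ∑ _i : X × A ⊕ HalfFns Y, (0 : ℝ) < ∑ i, x (Sum.inl i) by simpa using hP)
  obtain ⟨j₀, -, hj₀⟩ := Finset.exists_lt_of_sum_lt
    (show ∑ _j : Y × B ⊕ HalfFns X, (0 : ℝ) < ∑ j, y (Sum.inl j) by simpa using hQ)
  have hxH : ∀ f, x (Sum.inl (Sum.inr f)) = 0 := by
    intro f
    by_contra hne
    obtain ⟨q, a, r, b, h, -⟩ := accepted_of_GRow_add_GCol_eq V g δ _ _
      (hacc _ _ (lt_of_le_of_ne (hx.1 _) (Ne.symm hne)) hj₀)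
    simp at h
  have hyH : ∀ f, y (Sum.inl (Sum.inr f)) = 0 := by
    intro f
    by_contra hne
    obtain ⟨q, a, r, b, -, h, -⟩ := accepted_of_GRow_add_GCol_eq V g δ _ _
      (hacc _ _ hi₀ (lt_of_le_of_ne (hy.1 _) (Ne.symm hne)))
    simp at h
  have hGR : ∀ i j, 0 < x (Sum.inl i) → 0 < y (Sum.inl j) →
      GRow V g δ i j = 1 ∧ GCol V g δ i j = 1 := by
    intro i j hi hj
    obtain ⟨q, a, r, b, rfl, rfl, h⟩ := accepted_of_GRow_add_GCol_eq V g δ _ _ (hacc i j hi hj)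
    exact ⟨h, h⟩
  have ht : 4 * g * δ = 2 * (δ / 69) := by rw [hg]; ring
  have hYhalf := half_mass_le V g δ ε (δ / 69) hε ht (by positivity) x y hr hQ1 hyH i₀ hi₀
    (fun j => by
      rcases (hy.1 (Sum.inl j)).eq_or_lt with h | h
      · rw [← h, mul_zero]
      · rw [(hGR i₀ j hi₀ h).1, one_mul])
  have hXhalf := half_mass_le _ g δ ε (δ / 69) hε ht (by positivity) y x hc hP1 hxH j₀ hj₀
    (fun i => by
      rw [← GCol_eq_GRow_swap]
      rcases (hx.1 (Sum.inl i)).eq_or_lt with h | h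
      · rw [← h, mul_zero]
      · rw [(hGR i j₀ h hj₀).2, one_mul])
  let S : Finset X := Finset.univ.filter (fun q => ∃ a, 0 < x (Sum.inl (Sum.inl (q, a))))
  let T : Finset Y := Finset.univ.filter (fun r => ∃ b, 0 < y (Sum.inl (Sum.inl (r, b))))
  have hS := card_le_card_support_mul hX _ (isDist_colMarg x hx hP1 hxH) (δ / 69)
    (by linarith) hXhalf S (fun q hq => Finset.sum_eq_zero (fun a _ => by
      by_contra hne
      exact hq (Finset.mem_filter.mpr ⟨Finset.mem_univ q, a,
        lt_of_le_of_ne (hx.1 _) (Ne.symm hne)⟩)))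
  have hT := card_le_card_support_mul hY _ (isDist_colMarg y hy hQ1 hyH) (δ / 69)
    (by linarith) hYhalf T (fun r hr => Finset.sum_eq_zero (fun b _ => by
      by_contra hne
      exact hr (Finset.mem_filter.mpr ⟨Finset.mem_univ r, b,
        lt_of_le_of_ne (hy.1 _) (Ne.symm hne)⟩)))
  have hs₁ : ∀ q, ∃ a, q ∈ S → 0 < x (Sum.inl (Sum.inl (q, a))) := by
    intro q
    by_cases hq : q ∈ S
    · obtain ⟨a, ha⟩ := (Finset.mem_filter.mp hq).2
      exact ⟨a, fun _ => ha⟩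
    · exact ⟨Classical.arbitrary A, fun h => absurd h hq⟩
  have hs₂ : ∀ r, ∃ b, r ∈ T → 0 < y (Sum.inl (Sum.inl (r, b))) := by
    intro r
    by_cases hr : r ∈ T
    · obtain ⟨b, hb⟩ := (Finset.mem_filter.mp hr).2
      exact ⟨b, fun _ => hb⟩
    · exact ⟨Classical.arbitrary B, fun h => absurd h hr⟩
  choose s₁ hs₁ using hs₁
  choose s₂ hs₂ using hs₂
  have hval := card_mul_card_le_gameValue V hV s₁ s₂ S T
    (fun q hq r hr => (hGR _ _ (hs₁ q hq) (hs₂ r hr)).1)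
  have hn : (0 : ℝ) < Fintype.card X := by exact_mod_cast Fintype.card_pos
  have hm : (0 : ℝ) < Fintype.card Y := by exact_mod_cast Fintype.card_pos
  have hden : ∀ n k : ℝ, 0 < n → n ≤ k * (1 + δ / 69) → n * (1 - δ / 69) ≤ k := by
    intro n k hn hk
    have h1 : n * (1 - δ / 69) ≤ k * (1 + δ / 69) * (1 - δ / 69) :=
      mul_le_mul_of_nonneg_right hk (by linarith)
    have hk0 : 0 ≤ k := by
      by_contra hneg
      nlinarith
    nlinarith [mul_nonneg hk0 (sq_nonneg (δ / 69))]
  have hprod : (Fintype.card X * (1 - δ / 69)) * (Fintype.card Y * (1 - δ / 69))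
      ≤ (S.card : ℝ) * T.card :=
    mul_le_mul (hden _ _ hn hS) (hden _ _ hm hT)
      (mul_nonneg hm.le (by linarith)) (Nat.cast_nonneg _)
  have hle := hval.trans hω
  rw [one_div, inv_mul_le_iff₀ (mul_pos hn hm)] at hle
  have hfin : (1 - δ / 69) * (1 - δ / 69) ≤ 1 - δ := by
    refine le_of_mul_le_mul_left ?_ (mul_pos hn hm)
    linarith
  nlinarith [sq_nonneg (δ / 69)]
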